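/- Let X be a measurable space, Y a finite nonempty type, and let μ_k and μ_T be probability measures on X × Y. Let Θ be a countable type with prior probability mass function p satisfying p(θ) > 0 for all θ, and for each θ ∈ Θ let f_θ : X → Y be measurable; let H be a nonempty set of measurable functions X → Y containing every f_θ, and let f_0 ∈ H be a fixed measurable reference classifier. Let ℓ^{ce} : Θ × (X × Y) → ℝ be a loss with 0 ≤ ℓ^{ce} ≤ 1, measurable in (x,y) for each θ, let C > 0, and let ℓ^{kd} : Θ × (X × Y) → ℝ be a loss with 0 ≤ ℓ^{kd} ≤ C, measurable in (x,y) for each θ. Write R_μ(f) = μ({(x,y) : f x ≠ y}), R^{ce}(θ) = ∫ ℓ^{ce}(θ,·) dμ_k, R^{kd}(θ) = ∫ ℓ^{kd}(θ,·) dμ_k, and for a sample S = (s_1,…,s_m) ∈ (X × Y)^m write R̂^{ce}_S(θ) = (1/m) Σ_i ℓ^{ce}(θ, s_i) and R̂^{kd}_S(θ) = (1/m) Σ_i ℓ^{kd}(θ, s_i). Assume that for every θ ∈ Θ, R_{μ_k}(f_θ) ≤ R^{ce}(θ) + R^{kd}(θ). Then for every t > 0, every m ≥ 8, and every ε ∈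 (0,1), with probability at least 1 − 2ε over S drawn from the m-fold product measure μ_k^{⊗m}: for every θ ∈ Θ, R_{μ_T}(f_θ) ≤ R̂^{ce}_S(θ) + sqrt( (−log p(θ) + log(2·sqrt(m)) − log ε) / (2·m) ) + R_{μ_k}(f_0) + R_{μ_T}(f_0) + d_{f_θ}(μ_k, μ_T) + R̂^{kd}_S(θ) + (−log p(θ) − log ε) / (t·m) + t·C² / 8, where d_h(μ_k, μ_T) = sup_{g ∈ H} |μ_T^X({x : h x ≠ g x}) − μ_k^X({x : h x ≠ g x})| with μ^X the marginal of μ on X. -/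

import Mathlib

open MeasureTheory

/-- When the second factor is finite, the first marginal of a measure agrees with the measure of
the cylinder even on non-measurable sets. -/
lemma map_fst_apply_of_finite {X Y : Type*} [MeasurableSpace X] [MeasurableSpace Y] [Finite Y]
    [Nonempty Y] (μ : Measure (X × Y)) (s : Set X) :
    μ.map Prod.fst s = μ (Prod.fst ⁻¹' s) := by
  refine le_antisymm ?_ (Measure.le_map_apply measurable_fst.aemeasurable s)
  obtain ⟨B, hsB, hB, hμB⟩ := exists_measurable_superset μ (Prod.fst ⁻¹' s)
  have hA : MeasurableSet (⋂ y : Y, (fun x : X => (x, y)) ⁻¹' B) :=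
    MeasurableSet.iInter fun y => measurable_prodMk_right hB
  calc μ.map Prod.fst s
      ≤ μ.map Prod.fst (⋂ y : Y, (fun x : X => (x, y)) ⁻¹' B) :=
        measure_mono fun x hx => Set.mem_iInter.2 fun y => hsB hx
    _ = μ (Prod.fst ⁻¹' ⋂ y : Y, (fun x : X => (x, y)) ⁻¹' B) :=
        Measure.map_apply measurable_fst hA
    _ ≤ μ B := measure_mono fun z hz => Set.mem_iInter.1 hz z.2
    _ = μ (Prod.fst ⁻¹' s) := hμB

/-- Domain adaptation bound: the target risk of `h` is at most its source risk plus the risks of a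
reference classifier `g₀ ∈ H` and the discrepancy of `h` over `H`. -/
lemma risk_le_risk_add_discrepancy {X Y : Type*} [MeasurableSpace X] [MeasurableSpace Y]
    [Finite Y] [Nonempty Y] (μ ν : Measure (X × Y)) [IsProbabilityMeasure μ]
    [IsProbabilityMeasure ν] (H : Set (X → Y)) (h g₀ : X → Y) (hg₀ : g₀ ∈ H) :
    (ν {s : X × Y | h s.1 ≠ s.2}).toReal ≤
      (μ {s : X × Y | h s.1 ≠ s.2}).toReal
      + (μ {s : X × Y | g₀ s.1 ≠ s.2}).toReal
      + (ν {s : X × Y | g₀ s.1 ≠ s.2}).toReal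
      + sSup {r : ℝ | ∃ g ∈ H,
          r = |((ν.map Prod.fst) {x : X | h x ≠ g x}).toReal
              - ((μ.map Prod.fst) {x : X | h x ≠ g x}).toReal|} := by
  have hμ := Measure.isProbabilityMeasure_map (μ := μ) (f := Prod.fst) measurable_fst.aemeasurable
  have hν := Measure.isProbabilityMeasure_map (μ := ν) (f := Prod.fst) measurable_fst.aemeasurable
  have hbdd : BddAbove {r : ℝ | ∃ g ∈ H,
      r = |((ν.map Prod.fst) {x : X | h x ≠ g x}).toReal
          - ((μ.map Prod.fst) {x : X | h x ≠ g x}).toReal|} := by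
    refine ⟨1, ?_⟩
    rintro r ⟨g, -, rfl⟩
    exact abs_sub_le_of_nonneg_of_le measureReal_nonneg measureReal_le_one measureReal_nonneg
      measureReal_le_one
  have hdisc := (le_abs_self _).trans (le_csSup hbdd ⟨g₀, hg₀, rfl⟩)
  have htarget : (ν {s : X × Y | h s.1 ≠ s.2}).toReal ≤
      (ν {s : X × Y | g₀ s.1 ≠ s.2}).toReal
      + ((ν.map Prod.fst) {x : X | h x ≠ g₀ x}).toReal := by
    rw [map_fst_apply_of_finite]
    refine (measureReal_mono (μ := ν) ?_).trans (measureReal_union_le _ _)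
    intro s hs
    by_contra hcon
    simp_all
  have hsource : ((μ.map Prod.fst) {x : X | h x ≠ g₀ x}).toReal ≤
      (μ {s : X × Y | h s.1 ≠ s.2}).toReal + (μ {s : X × Y | g₀ s.1 ≠ s.2}).toReal := by
    rw [map_fst_apply_of_finite]
    refine (measureReal_mono (μ := μ) ?_).trans (measureReal_union_le _ _)
    intro s hs
    by_contra hcon
    simp_all
  linarith

/-- Hoeffding's inequality for the lower deviation of an empirical mean: a deviation `r` with
`C² log (1/δ) ≤ 2 m r²` has probability at most `δ`. -/
lemma measure_empirical_mean_add_le_integral_le {Z : Type*} [MeasurableSpace Z] (μ : Measure Z)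
    [IsProbabilityMeasure μ] {g : Z → ℝ} (hg : Measurable g) {C : ℝ} (hC : 0 < C)
    (hbound : ∀ z, g z ∈ Set.Icc (0 : ℝ) C) {m : ℕ} (hm : 0 < m) {r δ : ℝ} (hr : 0 ≤ r)
    (hδ : 0 < δ) (hrδ : C ^ 2 * -Real.log δ ≤ 2 * m * r ^ 2) :
    (Measure.pi fun _ : Fin m => μ) {S | (1 / m : ℝ) * ∑ i, g (S i) + r ≤ ∫ z, g z ∂μ} ≤
      ENNReal.ofReal δ := by
  have hm' : (0 : ℝ) < m := by exact_mod_cast hm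
  have hsub := (ProbabilityTheory.hasSubgaussianMGF_of_mem_Icc (μ := μ) hg.aemeasurable
    (ae_of_all _ hbound)).neg
  have hindep : ProbabilityTheory.iIndepFun
      (fun (i : Fin m) (S : Fin m → Z) => (-fun z => g z - ∫ z, g z ∂μ) (S i))
      (Measure.pi fun _ : Fin m => μ) :=
    ProbabilityTheory.iIndepFun_pi fun _ => (hg.sub_const _).neg.aemeasurable
  have hsubi : ∀ i ∈ (Finset.univ : Finset (Fin m)), ProbabilityTheory.HasSubgaussianMGF
      (fun S : Fin m → Z => (-fun z => g z - ∫ z, g z ∂μ) (S i)) ((‖C - 0‖₊ / 2) ^ 2)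
      (Measure.pi fun _ : Fin m => μ) := fun i _ => by
    refine ProbabilityTheory.HasSubgaussianMGF.of_map (Y := Function.eval i)
      (measurable_pi_apply i).aemeasurable ?_
    rwa [(measurePreserving_eval (fun _ : Fin m => μ) i).map_eq]
  have hoeff := ProbabilityTheory.HasSubgaussianMGF.measure_sum_ge_le_of_iIndepFun hindep hsubi
    (mul_nonneg hm'.le hr)
  have hexp : Real.exp (-(m * r) ^ 2 /
      (2 * ((∑ _i : Fin m, (‖C - 0‖₊ / 2) ^ 2 : NNReal) : ℝ))) ≤ δ := by
    rw [← Real.le_log_iff_exp_le hδ]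
    simp only [Finset.sum_const, Finset.card_univ, Fintype.card_fin, nsmul_eq_mul, NNReal.coe_mul,
      NNReal.coe_natCast, NNReal.coe_pow, NNReal.coe_div, coe_nnnorm, sub_zero, Real.norm_eq_abs,
      abs_of_pos hC, NNReal.coe_ofNat]
    rw [div_le_iff₀ (by positivity)]
    nlinarith
  refine (measure_mono fun S hS => ?_).trans
    ((ENNReal.le_ofReal_iff_toReal_le (measure_ne_top _ _) hδ.le).2
      (hoeff.trans (by simpa using hexp)))
  have hS' : (1 / m : ℝ) * ∑ i, g (S i) + r ≤ ∫ z, g z ∂μ := hS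
  have hmul := mul_le_mul_of_nonneg_left hS' hm'.le
  have hcancel : (m : ℝ) * ((1 / m : ℝ) * ∑ i, g (S i)) = ∑ i, g (S i) := by
    field_simp
  simp only [Set.mem_ofPred_eq, Pi.neg_apply, Finset.sum_neg_distrib, Finset.sum_sub_distrib,
    Finset.sum_const, Finset.card_univ, Fintype.card_fin, nsmul_eq_mul]
  linarith

/-- Union bound: if the complements of countably many events have measure at most `δ i` and
`∑ δ i = ε`, then all events hold simultaneously with probability at least `1 - ε`. -/
lemma one_sub_le_measure_forall {Ω ι : Type*} [MeasurableSpace Ω] [Countable ι] (P : Measure Ω)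
    [IsProbabilityMeasure P] (A : ι → Set Ω) {δ : ι → ℝ} {ε : ℝ} (hδ : ∀ i, 0 ≤ δ i)
    (hsum : HasSum δ ε) (hA : ∀ i, P (A i)ᶜ ≤ ENNReal.ofReal (δ i)) :
    1 - ε ≤ (P (⋂ i, A i)).toReal := by
  have hcompl : P (⋂ i, A i)ᶜ ≤ ENNReal.ofReal ε := by
    rw [Set.compl_iInter, ← hsum.tsum_eq, ENNReal.ofReal_tsum_of_nonneg hδ hsum.summable]
    exact (measure_iUnion_le _).trans (ENNReal.tsum_le_tsum hA)
  have hcompl' : P.real (⋂ i, A i)ᶜ ≤ ε :=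
    ENNReal.toReal_le_of_le_ofReal (hsum.nonneg hδ) hcompl
  have htotal : 1 ≤ P.real (⋂ i, A i) + P.real (⋂ i, A i)ᶜ := by
    have hunion := measureReal_union_le (μ := P) (⋂ i, A i) (⋂ i, A i)ᶜ
    rwa [Set.union_compl_self, probReal_univ] at hunion
  have hdef : P.real (⋂ i, A i) = (P (⋂ i, A i)).toReal := rfl
  linarith

/-- Countable-prior form of the paper's main generalization error bound
(Theorem 1 for FedHPL): with probability at least `1 − 2ε` over an i.i.d.
sample of size `m ≥ 8` from the local distribution `μk`, the test risk of
every model `f θ` is bounded by the empirical cross-entropy risk plus a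
square-root PAC-Bayes complexity term, the adaptation error of the reference
model `f0`, the distribution discrepancy, and the empirical distillation risk
plus its linear PAC-Bayes complexity term. -/
theorem fedhpl_generalization_bound
    {X Y : Type*} [MeasurableSpace X] [MeasurableSpace Y] [Fintype Y] [Nonempty Y]
    (μk μT : Measure (X × Y)) [IsProbabilityMeasure μk] [IsProbabilityMeasure μT]
    {Θ : Type*} [Countable Θ]
    (p : Θ → ℝ) (hp_pos : ∀ θ, 0 < p θ) (hp_sum : ∑' θ, p θ = 1)
    (f : Θ → X → Y) (hf : ∀ θ, Measurable (f θ))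
    (H : Set (X → Y)) (hH : H.Nonempty) (hHmeas : ∀ g ∈ H, Measurable g)
    (hfH : ∀ θ, f θ ∈ H)
    (f0 : X → Y) (hf0 : Measurable f0) (hf0H : f0 ∈ H)
    (ℓce : Θ → X × Y → ℝ) (hce_meas : ∀ θ, Measurable (ℓce θ))
    (hce_bound : ∀ θ s, ℓce θ s ∈ Set.Icc (0 : ℝ) 1)
    (C : ℝ) (hC : 0 < C)
    (ℓkd : Θ → X × Y → ℝ) (hkd_meas : ∀ θ, Measurable (ℓkd θ))
    (hkd_bound : ∀ θ s, ℓkd θ s ∈ Set.Icc (0 : ℝ) C)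
    (hdecomp : ∀ θ, (μk {s : X × Y | f θ s.1 ≠ s.2}).toReal ≤
        (∫ s, ℓce θ s ∂μk) + (∫ s, ℓkd θ s ∂μk))
    (t : ℝ) (ht : 0 < t) (m : ℕ) (hm : 8 ≤ m) (ε : ℝ) (hε : ε ∈ Set.Ioo (0 : ℝ) 1) :
    (1 - 2 * ε : ℝ) ≤
      ((Measure.pi fun _ : Fin m => μk) {S : Fin m → X × Y |
        ∀ θ : Θ, (μT {s : X × Y | f θ s.1 ≠ s.2}).toReal ≤
          (1 / m : ℝ) * ∑ i, ℓce θ (S i)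
          + Real.sqrt ((-Real.log (p θ) + Real.log (2 * Real.sqrt m)
              - Real.log ε) / (2 * m))
          + (μk {s : X × Y | f0 s.1 ≠ s.2}).toReal
          + (μT {s : X × Y | f0 s.1 ≠ s.2}).toReal
          + sSup {r : ℝ | ∃ g ∈ H,
              r = |((μT.map Prod.fst) {x : X | f θ x ≠ g x}).toReal
                  - ((μk.map Prod.fst) {x : X | f θ x ≠ g x}).toReal|}
          + (1 / m : ℝ) * ∑ i, ℓkd θ (S i)
          + (-Real.log (p θ) - Real.log ε) / (t * m)
          + t * C ^ 2 / 8}).toReal := by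
  have hm0 : 0 < m := by omega
  have hm' : (8 : ℝ) ≤ m := by exact_mod_cast hm
  have hsummable : Summable p := by
    by_contra hns
    simp [tsum_eq_zero_of_not_summable hns] at hp_sum
  have hsum : HasSum (fun θ => 2 * (p θ * ε)) (2 * ε) := by
    simpa [hp_sum] using (hsummable.hasSum.mul_right ε).mul_left 2
  rw [Set.ofPred_forall]
  refine one_sub_le_measure_forall _ _
    (fun θ => mul_nonneg zero_le_two (mul_nonneg (hp_pos θ).le hε.1.le)) hsum fun θ => ?_
  have hpε : 0 < p θ * ε := mul_pos (hp_pos θ) hε.1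
  have hp_le : p θ ≤ 1 := hp_sum ▸ hsummable.le_tsum θ fun j _ => (hp_pos j).le
  have hlogp : Real.log (p θ) ≤ 0 := Real.log_nonpos (hp_pos θ).le hp_le
  have hlogε : Real.log ε ≤ 0 := Real.log_nonpos hε.1.le hε.2.le
  have hlogm : 0 ≤ Real.log (2 * Real.sqrt m) := by
    refine Real.log_nonneg ?_
    have : 1 ≤ Real.sqrt m := Real.one_le_sqrt.2 (by linarith)
    linarith
  have hlogmul : Real.log (p θ * ε) = Real.log (p θ) + Real.log ε :=
    Real.log_mul (hp_pos θ).ne' hε.1.ne'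
  set r := Real.sqrt ((-Real.log (p θ) + Real.log (2 * Real.sqrt m) - Real.log ε) / (2 * m))
    with hr
  set a := (-Real.log (p θ) - Real.log ε) / (t * m) with ha
  have hr_sq : 2 * m * r ^ 2 = -Real.log (p θ) + Real.log (2 * Real.sqrt m) - Real.log ε := by
    rw [hr, Real.sq_sqrt (div_nonneg (by linarith) (by positivity))]
    field_simp
  have ha_nonneg : 0 ≤ a := div_nonneg (by linarith) (by positivity)
  have ha_mul : m * (t * a) = -Real.log (p θ) - Real.log ε := by
    rw [ha]
    field_simp
  have hce := measure_empirical_mean_add_le_integral_le μk (hce_meas θ) one_pos (hce_bound θ) hm0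
    (r := r) (Real.sqrt_nonneg _) hpε (by rw [hlogmul, hr_sq]; linarith)
  have hkd := measure_empirical_mean_add_le_integral_le μk (hkd_meas θ) hC (hkd_bound θ) hm0
    (r := a + t * C ^ 2 / 8) (by positivity) hpε (by
      have hlog : -Real.log (p θ * ε) = m * (t * a) := by rw [hlogmul, ha_mul]; ring
      rw [hlog]
      nlinarith [mul_nonneg (by linarith : (0 : ℝ) ≤ m) (sq_nonneg (a - t * C ^ 2 / 8))])
  rw [two_mul, ENNReal.ofReal_add hpε.le hpε.le]
  refine ((measure_mono ?_).trans (measure_union_le _ _)).trans (add_le_add hce hkd)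
  intro S hS
  by_contra hgood
  rw [Set.mem_union, not_or] at hgood
  obtain ⟨hgood_ce, hgood_kd⟩ := hgood
  simp only [Set.mem_ofPred_eq, not_le] at hgood_ce hgood_kd
  refine hS ?_
  rw [Set.mem_ofPred_eq]
  linarith [risk_le_risk_add_discrepancy μk μT H (f θ) f0 hf0H, hdecomp θ]
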